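/- arXiv:1802.05635 — 2 statements merged into one kernel-verified Lean document; each statement's English description precedes it below -/
import Mathlib

section
/- There exists a constant A > 0 depending only on K₀, σ_L, σ_U such that for all measurable functions b, b₀ : [0,1] → ℝ with |b(x)| ≤ K₀ and |b₀(x)| ≤ K₀ for all x ∈ [0,1], one has A² · max { ∫₀¹ π_{b₀}(x) log(π_{b₀}(x)/π_b(x)) dx , ∫₀¹ π_{b₀}(x) (log(π_{b₀}(x)/π_b(x)))² dx } ≤ ‖b₀ − b‖₂². -/
open MeasureTheory Real

/-- `I_b(x) = ∫₀ˣ 2 b(y) / σ(y)² dy`. -/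
noncomputable def Ib (σ b : ℝ → ℝ) (x : ℝ) : ℝ :=
  ∫ y in (0:ℝ)..x, 2 * b y / (σ y) ^ 2

/-- The normalising constant `H_b`. -/
noncomputable def Hb (σ b : ℝ → ℝ) : ℝ :=
  ∫ x in (0:ℝ)..1, (Real.exp (Ib σ b x) / (σ x) ^ 2) *
    (Real.exp (Ib σ b 1) * (∫ y in x..(1:ℝ), Real.exp (-(Ib σ b y))) +
      ∫ y in (0:ℝ)..x, Real.exp (-(Ib σ b y)))

/-- The invariant density `π_b`. -/
noncomputable def πb (σ b : ℝ → ℝ) (x : ℝ) : ℝ :=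
  (Real.exp (Ib σ b x) / (Hb σ b * (σ x) ^ 2)) *
    (Real.exp (Ib σ b 1) * (∫ y in x..(1:ℝ), Real.exp (-(Ib σ b y))) +
      ∫ y in (0:ℝ)..x, Real.exp (-(Ib σ b y)))

/-- The `L²([0,1])`-norm of a function. -/
noncomputable def L2norm (f : ℝ → ℝ) : ℝ :=
  Real.sqrt (∫ x in (0:ℝ)..1, f x ^ 2)

structure Adm (K₀ σL : ℝ) (σ b : ℝ → ℝ) : Prop where
  hσL : 0 < σL
  hσ : Measurable σ
  hlow : ∀ x ∈ Set.Icc (0:ℝ) 1, σL ≤ σ x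
  hb : Measurable b
  hK : ∀ x ∈ Set.Icc (0:ℝ) 1, |b x| ≤ K₀

theorem bdd_ii {f : ℝ → ℝ} (hf : Measurable f) (C : ℝ)
    (h : ∀ x ∈ Set.Icc (0:ℝ) 1, |f x| ≤ C) : IntervalIntegrable f volume 0 1 := by
  rw [intervalIntegrable_iff_integrableOn_Icc_of_le zero_le_one]
  refine Measure.integrableOn_of_bounded (M := C) (by simp) hf.aestronglyMeasurable ?_
  filter_upwards [ae_restrict_mem measurableSet_Icc] with x hx
  exact h x hx

theorem sub_ii {f : ℝ → ℝ} (hf : IntervalIntegrable f volume 0 1) {x y : ℝ}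
    (hx : x ∈ Set.Icc (0:ℝ) 1) (hy : y ∈ Set.Icc (0:ℝ) 1) : IntervalIntegrable f volume x y := by
  refine hf.mono_set ?_
  rw [Set.uIcc_of_le zero_le_one]
  exact Set.uIcc_subset_Icc hx hy

theorem prim_cont {f : ℝ → ℝ} (hf : IntervalIntegrable f volume 0 1) :
    ContinuousOn (fun x => ∫ y in (0:ℝ)..x, f y) (Set.Icc 0 1) := by
  have := intervalIntegral.continuousOn_primitive_interval
    (f := f) (a := 0) (b := 1) (μ := volume) (by
      rw [Set.uIcc_of_le zero_le_one]
      exact (intervalIntegrable_iff_integrableOn_Icc_of_le zero_le_one).1 hf)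
  rwa [Set.uIcc_of_le zero_le_one] at this

noncomputable def NN (σ b : ℝ → ℝ) (x : ℝ) : ℝ :=
  Real.exp (Ib σ b x) * (Real.exp (Ib σ b 1) * (∫ y in x..(1:ℝ), Real.exp (-(Ib σ b y))) +
      ∫ y in (0:ℝ)..x, Real.exp (-(Ib σ b y)))

section
variable {K₀ σL : ℝ} {σ b b₀ : ℝ → ℝ}

theorem Adm.ii_b (h : Adm K₀ σL σ b) : IntervalIntegrable b volume 0 1 :=
  bdd_ii h.hb _ h.hK

theorem Adm.inv_le (h : Adm K₀ σL σ b) {x : ℝ} (hx : x ∈ Set.Icc (0:ℝ) 1) :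
    1 / σ x ^ 2 ≤ 1 / σL ^ 2 := by
  have := h.hσL
  have := h.hlow x hx
  gcongr

theorem Adm.σpos (h : Adm K₀ σL σ b) {x : ℝ} (hx : x ∈ Set.Icc (0:ℝ) 1) : 0 < σ x :=
  h.hσL.trans_le (h.hlow x hx)

theorem Adm.ii_σ (h : Adm K₀ σL σ b) : IntervalIntegrable (fun x => 1 / σ x ^ 2) volume 0 1 := by
  refine bdd_ii (measurable_const.div (h.hσ.pow_const 2)) (1 / σL ^ 2) fun x hx => ?_
  rw [abs_of_nonneg (by positivity)]
  exact h.inv_le hx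

theorem Adm.ii_I (h : Adm K₀ σL σ b) :
    IntervalIntegrable (fun y => 2 * b y / (σ y) ^ 2) volume 0 1 := by
  refine bdd_ii ((h.hb.const_mul 2).div (h.hσ.pow_const 2)) (2 * K₀ * (1 / σL ^ 2)) fun x hx => ?_
  have h1 := h.inv_le hx
  have h2 := h.hK x hx
  have e : |2 * b x / σ x ^ 2| = 2 * |b x| * (1 / σ x ^ 2) := by
    rw [abs_div, abs_mul, abs_of_nonneg (sq_nonneg (σ x)), abs_two]; ring
  rw [e]
  have := abs_nonneg (b x)
  gcongr
  linarith

theorem Adm.cont_I (h : Adm K₀ σL σ b) : ContinuousOn (Ib σ b) (Set.Icc 0 1) :=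
  prim_cont h.ii_I

theorem Adm.cont_E (h : Adm K₀ σL σ b) :
    ContinuousOn (fun y => Real.exp (-(Ib σ b y))) (Set.Icc 0 1) :=
  h.cont_I.neg.rexp

theorem Adm.ii_E (h : Adm K₀ σL σ b) :
    IntervalIntegrable (fun y => Real.exp (-(Ib σ b y))) volume 0 1 :=
  ContinuousOn.intervalIntegrable (by rw [Set.uIcc_of_le zero_le_one]; exact h.cont_E)

theorem one_mem' : (1:ℝ) ∈ Set.Icc (0:ℝ) 1 := by simp
theorem zero_mem' : (0:ℝ) ∈ Set.Icc (0:ℝ) 1 := by simp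

theorem Adm.cont_N (h : Adm K₀ σL σ b) : ContinuousOn (NN σ b) (Set.Icc 0 1) := by
  have h1 := prim_cont h.ii_E
  have h2 : ContinuousOn (fun x => ∫ y in x..(1:ℝ), Real.exp (-(Ib σ b y))) (Set.Icc 0 1) := by
    have : ContinuousOn (fun x => (∫ y in (0:ℝ)..1, Real.exp (-(Ib σ b y))) -
        ∫ y in (0:ℝ)..x, Real.exp (-(Ib σ b y))) (Set.Icc 0 1) := continuousOn_const.sub h1
    refine this.congr fun x hx => ?_
    exact (intervalIntegral.integral_interval_sub_left h.ii_E (sub_ii h.ii_E zero_mem' hx)).symm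
  exact h.cont_I.rexp.mul ((continuousOn_const.mul h2).add h1)

theorem Adm.N_pos (h : Adm K₀ σL σ b) {x : ℝ} (hx : x ∈ Set.Icc (0:ℝ) 1) : 0 < NN σ b x := by
  unfold NN
  refine mul_pos (Real.exp_pos _) ?_
  have a1 : 0 ≤ ∫ y in x..(1:ℝ), Real.exp (-(Ib σ b y)) :=
    intervalIntegral.integral_nonneg hx.2 fun y _ => (Real.exp_pos _).le
  have a2 : 0 ≤ ∫ y in (0:ℝ)..x, Real.exp (-(Ib σ b y)) :=
    intervalIntegral.integral_nonneg hx.1 fun y _ => (Real.exp_pos _).le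
  rcases hx.1.lt_or_eq with h0 | h0
  · have : 0 < ∫ y in (0:ℝ)..x, Real.exp (-(Ib σ b y)) :=
      intervalIntegral.intervalIntegral_pos_of_pos_on (sub_ii h.ii_E zero_mem' hx)
        (fun y _ => Real.exp_pos _) h0
    positivity
  · have : 0 < ∫ y in x..(1:ℝ), Real.exp (-(Ib σ b y)) :=
      intervalIntegral.intervalIntegral_pos_of_pos_on (sub_ii h.ii_E hx one_mem')
        (fun y _ => Real.exp_pos _) (by linarith)
    positivity

theorem Hb_eq : Hb σ b = ∫ x in (0:ℝ)..1, 1 / σ x ^ 2 * NN σ b x := by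
  unfold Hb NN
  congr 1; ext x; ring

theorem πb_eq (x : ℝ) : πb σ b x = 1 / σ x ^ 2 * (NN σ b x / Hb σ b) := by
  unfold πb NN
  simp only [div_eq_mul_inv, mul_inv]; ring

theorem Adm.ii_mul (h : Adm K₀ σL σ b) {g : ℝ → ℝ} (hg : ContinuousOn g (Set.Icc 0 1)) :
    IntervalIntegrable (fun x => 1 / σ x ^ 2 * g x) volume 0 1 :=
  h.ii_σ.mul_continuousOn (by rw [Set.uIcc_of_le zero_le_one]; exact hg)

theorem Adm.H_pos (h : Adm K₀ σL σ b) : 0 < Hb σ b := by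
  rw [Hb_eq]
  refine intervalIntegral.intervalIntegral_pos_of_pos_on (h.ii_mul h.cont_N) (fun x hx => ?_)
    zero_lt_one
  have hx' := Set.Ioo_subset_Icc_self hx
  have := h.σpos hx'
  have := h.N_pos hx'
  positivity

theorem Adm.π_pos (h : Adm K₀ σL σ b) {x : ℝ} (hx : x ∈ Set.Icc (0:ℝ) 1) : 0 < πb σ b x := by
  rw [πb_eq]
  have := h.σpos hx
  have := h.N_pos hx
  have := h.H_pos
  positivity

theorem Adm.ii_πg (h : Adm K₀ σL σ b) {g : ℝ → ℝ} (hg : ContinuousOn g (Set.Icc 0 1)) :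
    IntervalIntegrable (fun x => πb σ b x * g x) volume 0 1 := by
  have := h.ii_mul ((h.cont_N.div_const (Hb σ b)).mul hg)
  refine this.congr (fun x _ => ?_)
  simp only [πb_eq, Pi.mul_apply]; ring

theorem Adm.ii_π (h : Adm K₀ σL σ b) : IntervalIntegrable (πb σ b) volume 0 1 := by
  simpa using h.ii_πg (g := fun _ => 1) continuousOn_const

theorem Adm.int_π (h : Adm K₀ σL σ b) : ∫ x in (0:ℝ)..1, πb σ b x = 1 := by
  have e : ∀ x, πb σ b x = (1 / σ x ^ 2 * NN σ b x) * (Hb σ b)⁻¹ := fun x => by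
    rw [πb_eq]; ring
  simp only [e]
  rw [intervalIntegral.integral_mul_const, ← Hb_eq]
  exact mul_inv_cancel₀ h.H_pos.ne'

theorem N_le (h : Adm K₀ σL σ b) (h₀ : Adm K₀ σL σ b₀) {δ : ℝ}
    (hδ : ∀ x ∈ Set.Icc (0:ℝ) 1, |Ib σ b₀ x - Ib σ b x| ≤ δ) {x : ℝ}
    (hx : x ∈ Set.Icc (0:ℝ) 1) : NN σ b₀ x ≤ Real.exp (3 * δ) * NN σ b x := by
  have d0 : 0 ≤ δ := (abs_nonneg _).trans (hδ 0 zero_mem')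
  have e1 : ∀ y ∈ Set.Icc (0:ℝ) 1, Real.exp (Ib σ b₀ y) ≤ Real.exp δ * Real.exp (Ib σ b y) :=
    fun y hy => by
      rw [← Real.exp_add]
      exact Real.exp_le_exp.2 (by have := abs_le.1 (hδ y hy); linarith)
  have e2 : ∀ y ∈ Set.Icc (0:ℝ) 1,
      Real.exp (-(Ib σ b₀ y)) ≤ Real.exp δ * Real.exp (-(Ib σ b y)) :=
    fun y hy => by
      rw [← Real.exp_add]
      exact Real.exp_le_exp.2 (by have := abs_le.1 (hδ y hy); linarith)
  have e3 : ∀ s ∈ Set.Icc (0:ℝ) 1, ∀ t ∈ Set.Icc (0:ℝ) 1, s ≤ t →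
      ∫ y in s..t, Real.exp (-(Ib σ b₀ y)) ≤ Real.exp δ * ∫ y in s..t, Real.exp (-(Ib σ b y)) := by
    intro s hs t ht hst
    rw [← intervalIntegral.integral_const_mul]
    exact intervalIntegral.integral_mono_on hst (sub_ii h₀.ii_E hs ht)
      ((sub_ii h.ii_E hs ht).const_mul _)
      fun y hy => e2 y ⟨hs.1.trans hy.1, hy.2.trans ht.2⟩
  have p1 := e3 x hx 1 one_mem' hx.2
  have p2 := e3 0 zero_mem' x hx hx.1
  have a1 : 0 ≤ ∫ y in x..(1:ℝ), Real.exp (-(Ib σ b₀ y)) :=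
    intervalIntegral.integral_nonneg hx.2 fun y _ => (Real.exp_pos _).le
  have a2 : 0 ≤ ∫ y in (0:ℝ)..x, Real.exp (-(Ib σ b₀ y)) :=
    intervalIntegral.integral_nonneg hx.1 fun y _ => (Real.exp_pos _).le
  have a3 : 0 ≤ ∫ y in (0:ℝ)..x, Real.exp (-(Ib σ b y)) :=
    intervalIntegral.integral_nonneg hx.1 fun y _ => (Real.exp_pos _).le
  unfold NN
  set P₀ := ∫ y in x..(1:ℝ), Real.exp (-(Ib σ b₀ y))
  set P := ∫ y in x..(1:ℝ), Real.exp (-(Ib σ b y))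
  set Q₀ := ∫ y in (0:ℝ)..x, Real.exp (-(Ib σ b₀ y))
  set Q := ∫ y in (0:ℝ)..x, Real.exp (-(Ib σ b y))
  have s1 : Q₀ ≤ Real.exp δ * (Real.exp δ * Q) :=
    p2.trans (le_mul_of_one_le_left (by positivity) (Real.one_le_exp d0))
  have e31 : Real.exp (3 * δ) = Real.exp δ * (Real.exp δ * Real.exp δ) := by
    rw [← Real.exp_add, ← Real.exp_add]; congr 1; ring
  calc _ ≤ (Real.exp δ * Real.exp (Ib σ b x)) *
        ((Real.exp δ * Real.exp (Ib σ b 1)) * (Real.exp δ * P) +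
          Real.exp δ * (Real.exp δ * Q)) := by
        have := e1 x hx
        have := e1 1 one_mem'
        gcongr
    _ = _ := by rw [e31]; ring

theorem H_le (h : Adm K₀ σL σ b) (h₀ : Adm K₀ σL σ b₀) {δ : ℝ}
    (hδ : ∀ x ∈ Set.Icc (0:ℝ) 1, |Ib σ b₀ x - Ib σ b x| ≤ δ) :
    Hb σ b₀ ≤ Real.exp (3 * δ) * Hb σ b := by
  rw [Hb_eq, Hb_eq, ← intervalIntegral.integral_const_mul]
  refine intervalIntegral.integral_mono_on zero_le_one (h₀.ii_mul h₀.cont_N)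
    ((h.ii_mul h.cont_N).const_mul _) fun x hx => ?_
  have := N_le h h₀ hδ hx
  calc _ ≤ 1 / σ x ^ 2 * (Real.exp (3 * δ) * NN σ b x) := by gcongr
    _ = _ := by ring

theorem π_le (h : Adm K₀ σL σ b) (h₀ : Adm K₀ σL σ b₀) {δ : ℝ}
    (hδ : ∀ x ∈ Set.Icc (0:ℝ) 1, |Ib σ b₀ x - Ib σ b x| ≤ δ) {x : ℝ}
    (hx : x ∈ Set.Icc (0:ℝ) 1) : πb σ b₀ x ≤ Real.exp (6 * δ) * πb σ b x := by
  have hN := N_le h h₀ hδ hx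
  have hH := H_le h₀ h (δ := δ) (fun x hx => by rw [abs_sub_comm]; exact hδ x hx)
  have := h.H_pos
  have := h₀.H_pos
  have hp := h.N_pos hx
  rw [πb_eq, πb_eq]
  have e : Real.exp (6 * δ) = Real.exp (3 * δ) * Real.exp (3 * δ) := by
    rw [← Real.exp_add]; congr 1; ring
  have key : NN σ b₀ x / Hb σ b₀ ≤ Real.exp (6 * δ) * (NN σ b x / Hb σ b) := by
    rw [← mul_div_assoc, div_le_div_iff₀ ‹_› ‹_›]
    calc _ ≤ (Real.exp (3 * δ) * NN σ b x) * (Real.exp (3 * δ) * Hb σ b₀) := by gcongr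
      _ = _ := by rw [e]; ring
  calc _ ≤ 1 / σ x ^ 2 * (Real.exp (6 * δ) * (NN σ b x / Hb σ b)) := by gcongr
    _ = _ := by ring

theorem log_le (h : Adm K₀ σL σ b) (h₀ : Adm K₀ σL σ b₀) {δ : ℝ}
    (hδ : ∀ x ∈ Set.Icc (0:ℝ) 1, |Ib σ b₀ x - Ib σ b x| ≤ δ) {x : ℝ}
    (hx : x ∈ Set.Icc (0:ℝ) 1) : |Real.log (πb σ b₀ x / πb σ b x)| ≤ 6 * δ := by
  have p := h.π_pos hx
  have p₀ := h₀.π_pos hx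
  have l1 := Real.log_le_log p₀ (π_le h h₀ hδ hx)
  have l2 := Real.log_le_log p (π_le h₀ h (δ := δ)
    (fun x hx => by rw [abs_sub_comm]; exact hδ x hx) hx)
  rw [Real.log_mul (Real.exp_pos _).ne' p.ne', Real.log_exp] at l1
  rw [Real.log_mul (Real.exp_pos _).ne' p₀.ne', Real.log_exp] at l2
  rw [Real.log_div p₀.ne' p.ne', abs_le]
  constructor <;> linarith

theorem cont_log (h : Adm K₀ σL σ b) (h₀ : Adm K₀ σL σ b₀) :
    ContinuousOn (fun x => Real.log (πb σ b₀ x / πb σ b x)) (Set.Icc 0 1) := by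
  have c : ContinuousOn (fun x => (NN σ b₀ x / Hb σ b₀) / (NN σ b x / Hb σ b)) (Set.Icc 0 1) :=
    (h₀.cont_N.div_const _).div (h.cont_N.div_const _)
      fun x hx => (div_pos (h.N_pos hx) h.H_pos).ne'
  have c2 := c.log fun x hx => (div_pos (div_pos (h₀.N_pos hx) h₀.H_pos)
    (div_pos (h.N_pos hx) h.H_pos)).ne'
  refine c2.congr fun x hx => ?_
  have := h.σpos hx
  simp only [πb_eq]
  rw [mul_div_mul_left _ _ (by positivity)]

theorem elem (L : ℝ) : L ≤ L ^ 2 * Real.exp |L| + (1 - Real.exp (-L)) := by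
  have h1 := Real.add_one_le_exp L
  have h2 := Real.add_one_le_exp (-L)
  have hp := Real.exp_pos (-L)
  have hm : Real.exp (-L) * Real.exp L = 1 := by rw [← Real.exp_add]; simp
  have k : Real.exp (-L) * (L + 1) ≤ 1 := by
    nlinarith [mul_le_mul_of_nonneg_left h1 hp.le]
  rcases le_total 0 L with h | h
  · rw [abs_of_nonneg h]
    have := Real.one_le_exp h
    nlinarith [sq_nonneg L, mul_nonneg h (sub_nonneg.2 h2)]
  · rw [abs_of_nonpos h]
    nlinarith [mul_nonneg (neg_nonneg.2 h) (sub_nonneg.2 k)]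

theorem main_bound (h : Adm K₀ σL σ b) (h₀ : Adm K₀ σL σ b₀) {δ : ℝ}
    (hδ : ∀ x ∈ Set.Icc (0:ℝ) 1, |Ib σ b₀ x - Ib σ b x| ≤ δ) :
    max (∫ x in (0:ℝ)..1, πb σ b₀ x * Real.log (πb σ b₀ x / πb σ b x))
          (∫ x in (0:ℝ)..1, πb σ b₀ x * (Real.log (πb σ b₀ x / πb σ b x)) ^ 2)
      ≤ 36 * δ ^ 2 * Real.exp (6 * δ) := by
  have d0 : 0 ≤ δ := (abs_nonneg _).trans (hδ 0 zero_mem')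
  have cl := cont_log h h₀
  have sqb : ∀ x ∈ Set.Icc (0:ℝ) 1, (Real.log (πb σ b₀ x / πb σ b x)) ^ 2 ≤ 36 * δ ^ 2 := by
    intro x hx
    have := pow_le_pow_left₀ (abs_nonneg _) (log_le h h₀ hδ hx) 2
    rw [sq_abs] at this
    linarith
  set C := 36 * δ ^ 2 * Real.exp (6 * δ) with hC
  have hC1 : 36 * δ ^ 2 ≤ C :=
    le_mul_of_one_le_right (by positivity) (Real.one_le_exp (by positivity))
  apply max_le
  · have i2 : IntervalIntegrable (fun x => πb σ b₀ x * C + (πb σ b₀ x - πb σ b x)) volume 0 1 :=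
      (h₀.ii_π.mul_const C).add (h₀.ii_π.sub h.ii_π)
    have := intervalIntegral.integral_mono_on zero_le_one (h₀.ii_πg cl) i2 (fun x hx => by
      have p := h.π_pos hx
      have p₀ := h₀.π_pos hx
      have e := elem (Real.log (πb σ b₀ x / πb σ b x))
      rw [Real.exp_neg, Real.exp_log (div_pos p₀ p), inv_div] at e
      have l := log_le h h₀ hδ hx
      have l2 := sqb x hx
      set L := Real.log (πb σ b₀ x / πb σ b x)
      have e2 : L ≤ C + (1 - πb σ b x / πb σ b₀ x) := by
        refine e.trans ?_
        rw [hC]; gcongr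
      calc πb σ b₀ x * L ≤ πb σ b₀ x * (C + (1 - πb σ b x / πb σ b₀ x)) := by gcongr
        _ = _ := by field_simp)
    refine this.trans (le_of_eq ?_)
    rw [intervalIntegral.integral_add (h₀.ii_π.mul_const C) (h₀.ii_π.sub h.ii_π),
      intervalIntegral.integral_sub h₀.ii_π h.ii_π, intervalIntegral.integral_mul_const,
      h.int_π, h₀.int_π]
    ring
  · have := intervalIntegral.integral_mono_on zero_le_one (h₀.ii_πg (cl.pow 2))
      (h₀.ii_π.mul_const C) (fun x hx => by
        have p₀ := h₀.π_pos hx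
        have := (sqb x hx).trans hC1
        simp only [Pi.pow_apply]
        gcongr)
    rw [intervalIntegral.integral_mul_const, h₀.int_π, one_mul] at this
    exact this

theorem Adm.I_diff (h : Adm K₀ σL σ b) (h₀ : Adm K₀ σL σ b₀) {x : ℝ}
    (hx : x ∈ Set.Icc (0:ℝ) 1) :
    |Ib σ b₀ x - Ib σ b x| ≤ 2 / σL ^ 2 * ∫ y in (0:ℝ)..1, |b₀ y - b y| := by
  have iab := (h₀.ii_b.sub h.ii_b).abs
  unfold Ib
  rw [← intervalIntegral.integral_sub (sub_ii h₀.ii_I zero_mem' hx) (sub_ii h.ii_I zero_mem' hx)]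
  refine (intervalIntegral.abs_integral_le_integral_abs hx.1).trans ?_
  rw [← intervalIntegral.integral_const_mul]
  have i1 := (h₀.ii_I.sub h.ii_I).abs
  have m1 : ∫ y in (0:ℝ)..x, |2 * b₀ y / σ y ^ 2 - 2 * b y / σ y ^ 2| ≤
      ∫ y in (0:ℝ)..1, |2 * b₀ y / σ y ^ 2 - 2 * b y / σ y ^ 2| :=
    intervalIntegral.integral_mono_interval le_rfl hx.1 hx.2
      (Filter.Eventually.of_forall fun y => abs_nonneg _) i1
  refine m1.trans (intervalIntegral.integral_mono_on zero_le_one i1 (iab.const_mul _) fun y hy => ?_)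
  have e : |2 * b₀ y / σ y ^ 2 - 2 * b y / σ y ^ 2| = 2 * (1 / σ y ^ 2) * |b₀ y - b y| := by
    have : 2 * b₀ y / σ y ^ 2 - 2 * b y / σ y ^ 2 = 2 * (1 / σ y ^ 2) * (b₀ y - b y) := by ring
    rw [this, abs_mul, abs_of_nonneg (by positivity : 0 ≤ 2 * (1 / σ y ^ 2))]
  rw [e, show 2 / σL ^ 2 = 2 * (1 / σL ^ 2) by ring]
  have := h.inv_le hy
  gcongr

theorem cs (h : Adm K₀ σL σ b) (h₀ : Adm K₀ σL σ b₀) :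
    (∫ y in (0:ℝ)..1, |b₀ y - b y|) ^ 2 ≤ ∫ y in (0:ℝ)..1, (b₀ y - b y) ^ 2 := by
  have iab : IntervalIntegrable (fun y => |b₀ y - b y|) volume 0 1 := (h₀.ii_b.sub h.ii_b).abs
  have isq : IntervalIntegrable (fun y => (b₀ y - b y) ^ 2) volume 0 1 := by
    refine bdd_ii ((h₀.hb.sub h.hb).pow_const 2) ((2 * K₀) ^ 2) fun x hx => ?_
    rw [abs_of_nonneg (sq_nonneg _)]
    have h1 := abs_le.1 (h.hK x hx)
    have h2 := abs_le.1 (h₀.hK x hx)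
    exact sq_le_sq' (by linarith) (by linarith)
  set m := ∫ y in (0:ℝ)..1, |b₀ y - b y| with hm
  have := intervalIntegral.integral_mono_on zero_le_one
    ((iab.const_mul (2 * m)).sub (intervalIntegrable_const (c := m ^ 2))) isq (fun y _ => by
      have := sq_nonneg (|b₀ y - b y| - m)
      have := sq_abs (b₀ y - b y)
      nlinarith)
  rw [intervalIntegral.integral_sub (iab.const_mul (2 * m)) intervalIntegrable_const,
    intervalIntegral.integral_const_mul, intervalIntegral.integral_const, ← hm] at this
  simp at this
  linarith

theorem m_le (h : Adm K₀ σL σ b) (h₀ : Adm K₀ σL σ b₀) :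
    ∫ y in (0:ℝ)..1, |b₀ y - b y| ≤ 2 * K₀ := by
  have := intervalIntegral.integral_mono_on zero_le_one (h₀.ii_b.sub h.ii_b).abs
    (intervalIntegrable_const (c := 2 * K₀)) (fun y hy => by
      have h1 := abs_le.1 (h.hK y hy)
      have h2 := abs_le.1 (h₀.hK y hy)
      exact abs_le.2 ⟨by linarith, by linarith⟩)
  simpa using this

end

theorem statement11 (K₀ σL σU : ℝ) (hK₀ : 0 < K₀) (hσL : 0 < σL) (hσLU : σL ≤ σU) :
    ∃ A > (0:ℝ), ∀ σ : ℝ → ℝ, Measurable σ →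
      (∀ x ∈ Set.Icc (0:ℝ) 1, σL ≤ σ x) →
      (∀ x ∈ Set.Icc (0:ℝ) 1, σ x ≤ σU) →
      ∀ b b₀ : ℝ → ℝ, Measurable b → Measurable b₀ →
      (∀ x ∈ Set.Icc (0:ℝ) 1, |b x| ≤ K₀) →
      (∀ x ∈ Set.Icc (0:ℝ) 1, |b₀ x| ≤ K₀) →
      A ^ 2 * max (∫ x in (0:ℝ)..1, πb σ b₀ x * Real.log (πb σ b₀ x / πb σ b x))
          (∫ x in (0:ℝ)..1, πb σ b₀ x * (Real.log (πb σ b₀ x / πb σ b x)) ^ 2)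
        ≤ L2norm (fun y => b₀ y - b y) ^ 2 := by
  refine ⟨σL ^ 2 / 12 * Real.exp (-(12 * K₀ / σL ^ 2)), by positivity, ?_⟩
  intro σ hσ hlow _ b b₀ hb hb₀ hK hK'
  have h : Adm K₀ σL σ b := ⟨hσL, hσ, hlow, hb, hK⟩
  have h₀ : Adm K₀ σL σ b₀ := ⟨hσL, hσ, hlow, hb₀, hK'⟩
  have hmain := main_bound h h₀ (fun x hx => h.I_diff h₀ hx)
  have hcs := cs h h₀
  have hml := m_le h h₀
  have hL : L2norm (fun y => b₀ y - b y) ^ 2 = ∫ y in (0:ℝ)..1, (b₀ y - b y) ^ 2 := by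
    unfold L2norm
    exact Real.sq_sqrt (intervalIntegral.integral_nonneg zero_le_one fun y _ => sq_nonneg _)
  rw [hL]
  set m := ∫ y in (0:ℝ)..1, |b₀ y - b y|
  refine le_trans ?_ hcs
  refine (mul_le_mul_of_nonneg_left hmain (sq_nonneg _)).trans ?_
  have hE : Real.exp (6 * (2 / σL ^ 2 * m)) ≤ Real.exp (24 * K₀ / σL ^ 2) := by
    apply Real.exp_le_exp.2
    have : 6 * (2 / σL ^ 2 * m) ≤ 6 * (2 / σL ^ 2 * (2 * K₀)) := by gcongr
    refine this.trans (le_of_eq ?_)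
    ring
  have hX : Real.exp (-(12 * K₀ / σL ^ 2)) ^ 2 * Real.exp (24 * K₀ / σL ^ 2) = 1 := by
    rw [← Real.exp_nat_mul, ← Real.exp_add, Real.exp_eq_one_iff]
    push_cast; ring
  calc _ ≤ (σL ^ 2 / 12 * Real.exp (-(12 * K₀ / σL ^ 2))) ^ 2 *
        (36 * (2 / σL ^ 2 * m) ^ 2 * Real.exp (24 * K₀ / σL ^ 2)) := by gcongr
    _ = ((σL ^ 2 / 12) ^ 2 * 36 * (2 / σL ^ 2 * m) ^ 2) *
        (Real.exp (-(12 * K₀ / σL ^ 2)) ^ 2 * Real.exp (24 * K₀ / σL ^ 2)) := by ring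
    _ = m ^ 2 := by
        rw [hX]; field_simp; norm_num
end

section
/- There exist universal constants C > 0 and λ > 0 such that for every m ≥ 1 and every u > C · max(log m, 1)^{1/2}, if (B_t)_{t ≥ 0} is a standard Brownian motion then P( sup { |B_t − B_s| / w_m(|t − s|) : s, t ∈ [0,m], s ≠ t, |t − s| ≤ e^{−2} } > u ) ≤ 2 e^{−λ u²}. -/
open MeasureTheory ProbabilityTheory

/-- The Brownian modulus of continuity `w_m(δ) = δ^{1/2}((log(1/δ))^{1/2} + (log m)^{1/2})`. -/
noncomputable def wmod (m δ : ℝ) : ℝ :=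
  Real.sqrt δ * (Real.sqrt (Real.log (1 / δ)) + Real.sqrt (Real.log m))

/-- The law of an increment. -/
lemma incr_law {Ω : Type} [MeasurableSpace Ω] (P : Measure Ω) [IsProbabilityMeasure P]
    (B : ℝ → Ω → ℝ) (hmeas : Measurable (Function.uncurry B))
    (hG : ∀ (n : ℕ) (t : Fin n → ℝ) (c : Fin n → ℝ),
          ∃ v : NNReal, Measure.map (fun ω => ∑ i, c i * B (t i) ω) P = gaussianReal 0 v)
    (hcov : ∀ s t : ℝ, 0 ≤ s → 0 ≤ t → ∫ ω, B s ω * B t ω ∂P = min s t)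
    (s t : ℝ) (hs : 0 ≤ s) (hst : s ≤ t) :
    Measure.map (fun ω => B t ω - B s ω) P = gaussianReal 0 (t - s).toNNReal := by
  have hm : ∀ t, Measurable (B t) := fun t => hmeas.comp (measurable_const.prodMk measurable_id)
  have hL : ∀ t, MemLp (B t) 2 P := by
    intro t
    obtain ⟨v, hv⟩ := hG 1 ![t] ![1]
    have hv' : Measure.map (B t) P = gaussianReal 0 v := by
      rw [← hv]; congr 1; ext ω; simp
    have h1 : MemLp id 2 (Measure.map (B t) P) := by
      rw [hv']; exact memLp_id_gaussianReal 2
    exact (memLp_map_measure_iff (by fun_prop) (hm t).aemeasurable).1 h1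
  obtain ⟨v, hv⟩ := hG 2 ![t, s] ![1, -1]
  have hv' : Measure.map (fun ω => B t ω - B s ω) P = gaussianReal 0 v := by
    rw [← hv]; congr 1; ext ω; simp; ring
  have ht : 0 ≤ t := hs.trans hst
  have h1 : ∫ ω, (B t ω - B s ω) ^ 2 ∂P = t - s := by
    have e : ∀ ω, (B t ω - B s ω) ^ 2 = B t ω * B t ω - 2 * (B s ω * B t ω) + B s ω * B s ω := by
      intro ω; ring
    simp_rw [e]
    have i1 : Integrable (fun ω => B t ω * B t ω) P := (hL t).integrable_mul (hL t)
    have i2 : Integrable (fun ω => B s ω * B t ω) P := (hL s).integrable_mul (hL t)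
    have i3 : Integrable (fun ω => B s ω * B s ω) P := (hL s).integrable_mul (hL s)
    have i4 : Integrable (fun ω => B t ω * B t ω - 2 * (B s ω * B t ω)) P :=
      i1.sub (i2.const_mul 2)
    rw [integral_add i4 i3, integral_sub i1 (i2.const_mul 2),
      integral_const_mul, hcov _ _ ht ht, hcov _ _ hs ht, hcov _ _ hs hs, min_self, min_self,
      min_eq_left hst]
    ring
  have h2 : ∫ ω, (B t ω - B s ω) ^ 2 ∂P = v := by
    have := integral_map (μ := P) (φ := fun ω => B t ω - B s ω) (f := fun x : ℝ => x ^ 2)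
      ((hm t).sub (hm s)).aemeasurable (by fun_prop)
    rw [← this, hv']
    have h3 := variance_id_gaussianReal (μ := 0) (v := v)
    rw [variance_eq_integral (by fun_prop)] at h3
    simpa using h3
  have : v = (t - s).toNNReal := by
    apply NNReal.coe_injective
    rw [Real.coe_toNNReal _ (by linarith), ← h2, h1]
  rw [hv', this]

lemma gauss_tail {Ω : Type} [MeasurableSpace Ω] (P : Measure Ω) [IsProbabilityMeasure P]
    (X : Ω → ℝ) (hX : Measurable X) (v : NNReal) (h : Measure.map X P = gaussianReal 0 v)
    (ε : ℝ) (hε : 0 ≤ ε) :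
    P {ω | ε < |X ω|} ≤ ENNReal.ofReal (2 * Real.exp (-ε ^ 2 / (2 * v))) := by
  have hsub : HasSubgaussianMGF X v P := by
    constructor
    · intro t
      have h1 : Integrable (fun x => Real.exp (t * x)) (Measure.map X P) := by
        rw [h]; exact integrable_exp_mul_gaussianReal t
      exact (integrable_map_measure (by fun_prop) hX.aemeasurable).1 h1
    · intro t
      rw [mgf_gaussianReal h]; simp
  have h1 := hsub.measure_ge_le hε
  have h2 := hsub.neg.measure_ge_le hε
  have hs : {ω | ε < |X ω|} ⊆ {ω | ε ≤ X ω} ∪ {ω | ε ≤ (-X) ω} := by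
    intro ω hω
    have hω' : ε < |X ω| := hω
    rcases lt_abs.1 hω' with h | h
    · exact Or.inl h.le
    · exact Or.inr h.le
  calc P {ω | ε < |X ω|} ≤ P {ω | ε ≤ X ω} + P {ω | ε ≤ (-X) ω} :=
        (measure_mono hs).trans (measure_union_le _ _)
    _ = ENNReal.ofReal (P.real {ω | ε ≤ X ω}) + ENNReal.ofReal (P.real {ω | ε ≤ (-X) ω}) := by
        simp [ofReal_measureReal]
    _ ≤ ENNReal.ofReal (Real.exp (-ε ^ 2 / (2 * v))) + ENNReal.ofReal (Real.exp (-ε ^ 2 / (2 * v))) := by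
        gcongr
    _ = _ := by
        rw [← ENNReal.ofReal_add (by positivity) (by positivity)]
        congr 1; ring

noncomputable def dd (L : ℝ) (n : ℕ) : ℝ := Real.sqrt ((n + 1 + L) / 2 ^ n)

lemma dd_step (L : ℝ) (hL : 0 ≤ L) (n : ℕ) (hn : 2 ≤ n) : 6 * dd L (n + 1) ≤ 5 * dd L n := by
  have hn' : (2:ℝ) ≤ n := by exact_mod_cast hn
  apply le_of_sq_le_sq _ (by unfold dd; positivity)
  unfold dd
  rw [mul_pow, mul_pow, Real.sq_sqrt (by positivity), Real.sq_sqrt (by positivity)]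
  rw [pow_succ (2:ℝ) n]
  push_cast
  have h2 : (0:ℝ) < 2 ^ n := by positivity
  rw [mul_div_assoc', mul_div_assoc', div_le_div_iff₀ (by positivity) h2]
  nlinarith [mul_nonneg h2.le (by nlinarith : (0:ℝ) ≤ 25 * (n + 1 + L) * 2 - 36 * (n + 1 + 1 + L))]

lemma floor_step (x : ℝ) (hx : 0 ≤ x) (n : ℕ) :
    ⌊x * 2 ^ (n + 1)⌋₊ = 2 * ⌊x * 2 ^ n⌋₊ ∨ ⌊x * 2 ^ (n + 1)⌋₊ = 2 * ⌊x * 2 ^ n⌋₊ + 1 := by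
  have e : x * 2 ^ (n + 1) = 2 * (x * 2 ^ n) := by ring
  rw [e]
  have hy : 0 ≤ x * 2 ^ n := by positivity
  generalize x * 2 ^ n = y at hy
  have h1 := Nat.floor_le hy
  have h2 := Nat.lt_floor_add_one y
  have h3 : 2 * ⌊y⌋₊ ≤ ⌊2 * y⌋₊ := Nat.le_floor (by push_cast; linarith)
  have h4 : ⌊2 * y⌋₊ < 2 * ⌊y⌋₊ + 2 := (Nat.floor_lt (by positivity)).2 (by push_cast; linarith)
  omega

lemma dyadic_tendsto (x : ℝ) (hx : 0 ≤ x) :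
    Filter.Tendsto (fun n : ℕ => (⌊x * 2 ^ n⌋₊ : ℝ) / 2 ^ n) Filter.atTop (nhds x) :=
  (tendsto_nat_floor_mul_div_atTop hx).comp
    (tendsto_pow_atTop_atTop_of_one_lt (by norm_num : (1:ℝ) < 2))

lemma chain (f : ℝ → ℝ) (hf : Continuous f) (N : ℕ) (L a : ℝ) (hL : 0 ≤ L) (ha : 0 ≤ a)
    (hgood : ∀ n : ℕ, ∀ k < N * 2 ^ n, |f (((k + 1 : ℕ) : ℝ) / 2 ^ n) - f ((k : ℝ) / 2 ^ n)| ≤ a * dd L n)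
    (x : ℝ) (hx : 0 ≤ x) (hxN : x ≤ N) (n : ℕ) (hn : 2 ≤ n) :
    |f x - f ((⌊x * 2 ^ n⌋₊ : ℝ) / 2 ^ n)| ≤ a * (5 * dd L n) := by
  have key : ∀ p : ℕ, |f ((⌊x * 2 ^ (n + p)⌋₊ : ℝ) / 2 ^ (n + p)) - f ((⌊x * 2 ^ n⌋₊ : ℝ) / 2 ^ n)|
      ≤ a * (5 * dd L n) - a * (5 * dd L (n + p)) := by
    intro p
    induction p with
    | zero => simp
    | succ p ih =>
      have hst : |f ((⌊x * 2 ^ (n + p + 1)⌋₊ : ℝ) / 2 ^ (n + p + 1))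
          - f ((⌊x * 2 ^ (n + p)⌋₊ : ℝ) / 2 ^ (n + p))| ≤ a * dd L (n + p + 1) := by
        have e : (⌊x * 2 ^ (n + p)⌋₊ : ℝ) / 2 ^ (n + p)
            = ((2 * ⌊x * 2 ^ (n + p)⌋₊ : ℕ) : ℝ) / 2 ^ (n + p + 1) := by
          push_cast; field_simp; ring
        rcases floor_step x hx (n + p) with h | h
        · rw [e, h]; simp; unfold dd; positivity
        · rw [e, h]
          apply hgood
          have : ⌊x * 2 ^ (n + p + 1)⌋₊ ≤ N * 2 ^ (n + p + 1) := by
            apply Nat.floor_le_of_le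
            push_cast
            gcongr
          omega
      have h3 := mul_le_mul_of_nonneg_left (dd_step L hL (n + p) (by omega)) ha
      have := abs_sub_le (f ((⌊x * 2 ^ (n + p + 1)⌋₊ : ℝ) / 2 ^ (n + p + 1)))
        (f ((⌊x * 2 ^ (n + p)⌋₊ : ℝ) / 2 ^ (n + p))) (f ((⌊x * 2 ^ n⌋₊ : ℝ) / 2 ^ n))
      rw [← add_assoc]
      linarith
  have hlim : Filter.Tendsto (fun p : ℕ => |f ((⌊x * 2 ^ (n + p)⌋₊ : ℝ) / 2 ^ (n + p))
      - f ((⌊x * 2 ^ n⌋₊ : ℝ) / 2 ^ n)|) Filter.atTop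
      (nhds |f x - f ((⌊x * 2 ^ n⌋₊ : ℝ) / 2 ^ n)|) := by
    have h1 : Filter.Tendsto (fun p : ℕ => n + p) Filter.atTop Filter.atTop :=
      Filter.tendsto_atTop_mono (fun p => Nat.le_add_left p n) Filter.tendsto_id
    have h2 := (hf.tendsto x).comp ((dyadic_tendsto x hx).comp h1)
    exact (h2.sub_const _).abs
  refine le_of_tendsto' hlim (fun p => (key p).trans ?_)
  have : 0 ≤ a * (5 * dd L (n + p)) := by unfold dd; positivity
  linarith

lemma modulus (f : ℝ → ℝ) (hf : Continuous f) (N : ℕ) (m u : ℝ) (hm : 1 ≤ m) (hu : 0 ≤ u)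
    (hgood : ∀ n : ℕ, ∀ k < N * 2 ^ n,
      |f (((k + 1 : ℕ) : ℝ) / 2 ^ n) - f ((k : ℝ) / 2 ^ n)| ≤ (u / 30) * dd (Real.log m) n)
    (s t : ℝ) (hs : 0 ≤ s) (hst : s < t) (htN : t ≤ N) (hd : t - s ≤ Real.exp (-2)) :
    |f t - f s| ≤ u * wmod m (t - s) := by
  have hL : 0 ≤ Real.log m := Real.log_nonneg hm
  have hδ : 0 < t - s := by linarith
  have he : Real.exp (-2) < 1 / 4 := by
    have h1 := Real.exp_one_gt_d9
    have : Real.exp 2 = Real.exp 1 * Real.exp 1 := by rw [← Real.exp_add]; norm_num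
    rw [Real.exp_neg, inv_eq_one_div]
    apply one_div_lt_one_div_of_lt (by norm_num)
    nlinarith
  obtain ⟨n, hn1, hn2⟩ := exists_nat_pow_near_of_lt_one hδ (by linarith : t - s ≤ 1)
    (by norm_num : (0:ℝ) < 1 / 2) (by norm_num)
  have hn : 2 ≤ n := by
    by_contra hcon
    have : (1 / 2 : ℝ) ^ 2 ≤ (1 / 2) ^ (n + 1) :=
      pow_le_pow_of_le_one (by norm_num) (by norm_num) (by omega)
    linarith
  have hn' : (2:ℝ) ≤ n := by exact_mod_cast hn
  have ha : 0 ≤ u / 30 := by positivity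
  have c1 := chain f hf N _ _ hL ha hgood s hs (by linarith) n hn
  have c2 := chain f hf N _ _ hL ha hgood t (by linarith) htN n hn
  have p2 : (0:ℝ) < 2 ^ n := by positivity
  have hdn : (t - s) * 2 ^ n ≤ 1 := by
    have := mul_le_mul_of_nonneg_right hn2 p2.le
    rwa [← mul_pow, show (1 / 2 * 2 : ℝ) = 1 by norm_num, one_pow] at this
  have c3 : |f ((⌊t * 2 ^ n⌋₊ : ℝ) / 2 ^ n) - f ((⌊s * 2 ^ n⌋₊ : ℝ) / 2 ^ n)|
      ≤ (u / 30) * dd (Real.log m) n := by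
    have q1 : ⌊s * 2 ^ n⌋₊ ≤ ⌊t * 2 ^ n⌋₊ := Nat.floor_mono (by gcongr)
    have q2 : ⌊t * 2 ^ n⌋₊ < ⌊s * 2 ^ n⌋₊ + 2 := by
      apply (Nat.floor_lt (by nlinarith)).2
      have := Nat.lt_floor_add_one (s * 2 ^ n)
      push_cast
      linarith
    have q3 : ⌊t * 2 ^ n⌋₊ ≤ N * 2 ^ n := by
      apply Nat.floor_le_of_le
      push_cast
      gcongr
    have q4 : ⌊t * 2 ^ n⌋₊ = ⌊s * 2 ^ n⌋₊ ∨ ⌊t * 2 ^ n⌋₊ = ⌊s * 2 ^ n⌋₊ + 1 := by omega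
    rcases q4 with h | h
    · rw [h]; simp; unfold dd; positivity
    · rw [h]; apply hgood; omega
  have hlog : (n + 1 : ℝ) / 3 ≤ Real.log (1 / (t - s)) := by
    have h1 : Real.log ((2:ℝ) ^ n) ≤ Real.log (1 / (t - s)) := by
      apply Real.log_le_log p2
      rw [le_div_iff₀ hδ]; linarith
    rw [Real.log_pow] at h1
    have := Real.log_two_gt_d9
    nlinarith
  have hw : (11 / 30) * dd (Real.log m) n ≤ wmod m (t - s) := by
    have hl0 : 0 ≤ Real.log (1 / (t - s)) := by linarith
    have w1 : Real.sqrt (Real.log (1 / (t - s)) + Real.log m)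
        ≤ Real.sqrt (Real.log (1 / (t - s))) + Real.sqrt (Real.log m) :=
      by
      apply Real.sqrt_le_iff.2 ⟨by positivity, ?_⟩
      nlinarith [Real.sq_sqrt hl0, Real.sq_sqrt hL, Real.sqrt_nonneg (Real.log (1 / (t - s))),
        Real.sqrt_nonneg (Real.log m), mul_nonneg (Real.sqrt_nonneg (Real.log (1 / (t - s)))) (Real.sqrt_nonneg (Real.log m))]
    have w2 : Real.sqrt (t - s) * Real.sqrt (Real.log (1 / (t - s)) + Real.log m)
        ≤ wmod m (t - s) := by unfold wmod; gcongr
    refine le_trans ?_ w2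
    rw [← Real.sqrt_mul hδ.le]
    apply Real.le_sqrt_of_sq_le
    unfold dd
    rw [mul_pow, Real.sq_sqrt (by positivity)]
    have w3 : ((1:ℝ) / 2) ^ (n + 1) = 1 / (2 * 2 ^ n) := by rw [div_pow, one_pow, pow_succ]; ring
    rw [w3] at hn1
    calc (11 / 30 : ℝ) ^ 2 * ((n + 1 + Real.log m) / 2 ^ n)
        ≤ (1 / 6) * ((n + 1 + Real.log m) / 2 ^ n) := by gcongr; norm_num
      _ = (1 / (2 * 2 ^ n)) * ((n + 1 + Real.log m) / 3) := by field_simp; ring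
      _ ≤ (t - s) * (Real.log (1 / (t - s)) + Real.log m) := by
          gcongr
          linarith
  have := mul_le_mul_of_nonneg_left hw hu
  rw [abs_le] at *
  constructor <;> linarith [c1.1, c1.2, c2.1, c2.2, c3.1, c3.2]

theorem statement13 :
    ∃ C > (0:ℝ), ∃ lam > (0:ℝ),
      ∀ m : ℝ, 1 ≤ m →
      ∀ u : ℝ, C * Real.sqrt (max (Real.log m) 1) < u →
      ∀ (Ω : Type) (_ : MeasurableSpace Ω) (P : Measure Ω), IsProbabilityMeasure P →
      ∀ B : ℝ → Ω → ℝ,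
        -- joint measurability
        Measurable (Function.uncurry B) →
        -- continuous sample paths
        (∀ᵐ ω ∂P, Continuous fun t => B t ω) →
        -- centered Gaussian process: every finite linear combination is centered Gaussian
        (∀ (n : ℕ) (t : Fin n → ℝ) (c : Fin n → ℝ),
          ∃ v : NNReal, Measure.map (fun ω => ∑ i, c i * B (t i) ω) P = gaussianReal 0 v) →
        -- covariance `E[B_s B_t] = min(s,t)`
        (∀ s t : ℝ, 0 ≤ s → 0 ≤ t → ∫ ω, B s ω * B t ω ∂P = min s t) →
        P {ω | u < sSup {r : ℝ | ∃ s t : ℝ, s ∈ Set.Icc 0 m ∧ t ∈ Set.Icc 0 m ∧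
              s ≠ t ∧ |t - s| ≤ Real.exp (-2) ∧ r = |B t ω - B s ω| / wmod m |t - s|}}
          ≤ ENNReal.ofReal (2 * Real.exp (-lam * u ^ 2)) := by
  refine ⟨100, by norm_num, 1 / 3600, by norm_num, ?_⟩
  intro m hm u hu Ω _ P hP B hmeas hcont hG hcov
  have hL : 0 ≤ Real.log m := Real.log_nonneg hm
  have hu100 : 100 < u := by
    refine lt_of_le_of_lt ?_ hu
    have : 1 ≤ Real.sqrt (max (Real.log m) 1) := Real.one_le_sqrt.2 (le_max_right _ _)
    linarith
  have hu0 : 0 ≤ u := by linarith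
  have hBm : ∀ t, Measurable (B t) := fun t => hmeas.comp (measurable_const.prodMk measurable_id)
  set N : ℕ := ⌈m⌉₊ with hN
  set K : ℝ := u ^ 2 / 1800 with hK
  have hK4 : 4 ≤ K := by rw [hK, le_div_iff₀ (by norm_num)]; nlinarith
  let bad : ℕ → ℕ → Set Ω := fun n k => {ω | (u / 30) * dd (Real.log m) n
    < |B (((k + 1 : ℕ) : ℝ) / 2 ^ n) ω - B ((k : ℝ) / 2 ^ n) ω|}
  have hbad : ∀ n k, P (bad n k) ≤
      ENNReal.ofReal (2 * Real.exp (-K * (n + 1 + Real.log m))) := by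
    intro n k
    have hle : (k : ℝ) / 2 ^ n ≤ ((k + 1 : ℕ) : ℝ) / 2 ^ n := by
      push_cast; gcongr; linarith
    have law := incr_law P B hmeas hG hcov _ _ (by positivity) hle
    have := gauss_tail P _ ((hBm _).sub (hBm _)) _ law ((u / 30) * dd (Real.log m) n)
      (by unfold dd; positivity)
    refine this.trans (le_of_eq ?_)
    congr 3
    rw [Real.coe_toNNReal _ (by linarith)]
    unfold dd
    rw [mul_pow, Real.sq_sqrt (by positivity), hK]
    push_cast
    field_simp
    ring
  have hNm : (N : ℝ) ≤ 2 * Real.exp (Real.log m) := by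
    rw [Real.exp_log (by linarith)]
    have := Nat.ceil_lt_add_one (by linarith : 0 ≤ m)
    linarith
  have hexp4 : 4 ≤ Real.exp (K / 2) := by
    have h1 : Real.exp 2 ≤ Real.exp (K / 2) := Real.exp_le_exp.2 (by linarith)
    have h2 := Real.exp_one_gt_d9
    have : Real.exp 2 = Real.exp 1 * Real.exp 1 := by rw [← Real.exp_add]; norm_num
    nlinarith
  have hexpK : 4 * Real.exp (-K) ≤ Real.exp (-(K / 2)) := by
    have : Real.exp (-(K / 2)) = Real.exp (K / 2) * Real.exp (-K) := by
      rw [← Real.exp_add]; congr 1; ring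
    rw [this]; gcongr
  have hlevel : ∀ n : ℕ, P (⋃ k ∈ Finset.range (N * 2 ^ n), bad n k)
      ≤ ENNReal.ofReal (4 * Real.exp (-K) * (1 / 2) ^ n) := by
    intro n
    refine (measure_biUnion_finset_le _ _).trans ?_
    refine (Finset.sum_le_sum (fun k _ => hbad n k)).trans ?_
    rw [Finset.sum_const, Finset.card_range, nsmul_eq_mul, ← ENNReal.ofReal_natCast,
      ← ENNReal.ofReal_mul (by positivity)]
    apply ENNReal.ofReal_le_ofReal
    push_cast
    have e1 : Real.exp (-K * (n + 1 + Real.log m))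
        = Real.exp (-K) * Real.exp (-K) ^ n * Real.exp (-K * Real.log m) := by
      rw [← Real.exp_nat_mul, ← Real.exp_add, ← Real.exp_add]; congr 1; ring
    have e2 : Real.exp (-K * Real.log m) ≤ Real.exp (-Real.log m) :=
      Real.exp_le_exp.2 (by nlinarith)
    have e3 : Real.exp (-K) ≤ 1 / 4 := by
      have : Real.exp (-(K / 2)) ≤ 1 := Real.exp_le_one_iff.2 (by linarith)
      linarith
    have e4 : Real.exp (Real.log m) * Real.exp (-Real.log m) = 1 := by
      rw [← Real.exp_add]; simp
    rw [e1]
    calc (N : ℝ) * 2 ^ n * (2 * (Real.exp (-K) * Real.exp (-K) ^ n * Real.exp (-K * Real.log m)))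
        ≤ (2 * Real.exp (Real.log m)) * 2 ^ n *
          (2 * (Real.exp (-K) * (1 / 4) ^ n * Real.exp (-Real.log m))) := by gcongr
      _ = 4 * Real.exp (-K) * (2 ^ n * (1 / 4) ^ n)
            * (Real.exp (Real.log m) * Real.exp (-Real.log m)) := by ring
      _ = 4 * Real.exp (-K) * (1 / 2) ^ n := by
          rw [e4, ← mul_pow]; norm_num
  have hsub : {ω | u < sSup {r : ℝ | ∃ s t : ℝ, s ∈ Set.Icc 0 m ∧ t ∈ Set.Icc 0 m ∧
              s ≠ t ∧ |t - s| ≤ Real.exp (-2) ∧ r = |B t ω - B s ω| / wmod m |t - s|}}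
      ⊆ {ω | ¬ Continuous fun t => B t ω} ∪
        ⋃ n : ℕ, ⋃ k ∈ Finset.range (N * 2 ^ n), bad n k := by
    intro ω hω
    by_contra hcon
    rw [Set.mem_union, not_or] at hcon
    obtain ⟨hc, hb⟩ := hcon
    have hc' : Continuous fun t => B t ω := not_not.1 hc
    have hgood : ∀ n : ℕ, ∀ k < N * 2 ^ n,
        |B (((k + 1 : ℕ) : ℝ) / 2 ^ n) ω - B ((k : ℝ) / 2 ^ n) ω|
          ≤ (u / 30) * dd (Real.log m) n := by
      intro n k hk
      by_contra hlt
      apply hb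
      simp only [Set.mem_iUnion]
      exact ⟨n, k, Finset.mem_range.2 hk, not_le.1 hlt⟩
    have hmN : m ≤ N := Nat.le_ceil m
    refine absurd hω (not_lt.2 (Real.sSup_le ?_ hu0))
    rintro r ⟨s, t, hs, ht, hne, hd, rfl⟩
    apply div_le_of_le_mul₀ (by unfold wmod; positivity) hu0
    rcases lt_or_gt_of_ne hne with h | h
    · rw [abs_of_pos (sub_pos.2 h)] at hd ⊢
      exact modulus _ hc' N m u hm hu0 hgood s t hs.1 h (ht.2.trans hmN) hd
    · rw [abs_sub_comm t s] at hd ⊢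
      rw [abs_of_pos (sub_pos.2 h)] at hd ⊢
      rw [abs_sub_comm]
      exact modulus _ hc' N m u hm hu0 hgood t s ht.1 h (hs.2.trans hmN) hd
  refine (measure_mono hsub).trans ((measure_union_le _ _).trans ?_)
  have h0 : P {ω | ¬ Continuous fun t => B t ω} = 0 := hcont
  rw [h0, zero_add]
  refine (measure_iUnion_le _).trans ((ENNReal.tsum_le_tsum hlevel).trans ?_)
  rw [← ENNReal.ofReal_tsum_of_nonneg (fun n => by positivity)
    (summable_geometric_two.mul_left _), tsum_mul_left, tsum_geometric_two]
  apply ENNReal.ofReal_le_ofReal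
  have : -(1 / 3600) * u ^ 2 = -(K / 2) := by rw [hK]; ring
  rw [this]
  linarith
end
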